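/- arXiv:2001.06162 — 3 statements merged into one kernel-verified Lean document; each statement's English description precedes it below -/
import Mathlib

section
/- For every integer m ≥ 3 with m ≠ 7, there exists a permutation a₁, a₂, …, a_m of {1, 2, …, m} such that, defining for each odd index i the weight w(i) = a_i plus its existing neighbors a_{i-1} and a_{i+1}, there exist integers x ≠ y with w(i) = x for all odd i with i ≡ 1 (mod 4) and w(i) = y for all odd i with i ≡ 3 (mod 4). -/
/-- Weight of position `i` (1-based) in a sequence of length `m` given by `a`:
the sum of `a i` and its existing neighbors. -/
def seqWeight (m : Nat) (a : Nat → Nat) (i : Nat) : Nat :=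
  (if 2 ≤ i then a (i-1) else 0) + a i + (if i + 1 ≤ m then a (i+1) else 0)

theorem twoSum_of_parts (m : ℕ) (B C : ℕ → ℕ) (x y : ℕ) (hxy : x ≠ y)
    (hB : ∀ j, 1 ≤ j → 2 * j ≤ m → 1 ≤ B j ∧ B j ≤ m)
    (hC : ∀ j, 2 * j + 1 ≤ m → 1 ≤ C j ∧ C j ≤ m)
    (hBB : ∀ j l, 1 ≤ j → j < l → 2 * l ≤ m → B j ≠ B l)
    (hCC : ∀ j l, j < l → 2 * l + 1 ≤ m → C j ≠ C l)
    (hBC : ∀ j l, 1 ≤ j → 2 * j ≤ m → 2 * l + 1 ≤ m → B j ≠ C l)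
    (hw : ∀ j, 2 * j + 1 ≤ m →
      (if 1 ≤ j then B j else 0) + C j + (if 2 * j + 2 ≤ m then B (j + 1) else 0)
        = if j % 2 = 0 then x else y) :
    ∃ a : ℕ → ℕ, Set.BijOn a (Set.Icc 1 m) (Set.Icc 1 m) ∧
      ∃ x y : ℕ, x ≠ y ∧
        (∀ i, 1 ≤ i → i ≤ m → i % 4 = 1 → seqWeight m a i = x) ∧
        (∀ i, 1 ≤ i → i ≤ m → i % 4 = 3 → seqWeight m a i = y) := by
  obtain ⟨a, ha⟩ : ∃ a : ℕ → ℕ, a = fun i => if i % 2 = 0 then B (i / 2) else C (i / 2) :=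
    ⟨_, rfl⟩
  have hae : ∀ j, a (2 * j) = B j := by
    intro j
    have h1 : 2 * j % 2 = 0 := by omega
    have h2 : 2 * j / 2 = j := by omega
    simp only [ha, h1, h2, if_true]
  have hao : ∀ j, a (2 * j + 1) = C j := by
    intro j
    have h1 : ¬ (2 * j + 1) % 2 = 0 := by omega
    have h2 : (2 * j + 1) / 2 = j := by omega
    simp only [ha, h1, h2, if_false]
  have hmaps : Set.MapsTo a (Set.Icc 1 m) (Set.Icc 1 m) := by
    intro i hi
    rw [Set.mem_Icc] at hi ⊢
    rcases Nat.even_or_odd' i with ⟨j, rfl | rfl⟩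
    · rw [hae]; exact hB j (by omega) (by omega)
    · rw [hao]; exact hC j (by omega)
  have hinj : Set.InjOn a (Set.Icc 1 m) := by
    intro i hi i' hi' h
    rw [Set.mem_Icc] at hi hi'
    rcases Nat.even_or_odd' i with ⟨j, rfl | rfl⟩ <;>
    rcases Nat.even_or_odd' i' with ⟨l, rfl | rfl⟩ <;>
    simp only [hae, hao] at h
    · rcases Nat.lt_trichotomy j l with g | g | g
      · exact absurd h (hBB j l (by omega) g (by omega))
      · rw [g]
      · exact absurd h.symm (hBB l j (by omega) g (by omega))
    · exact absurd h (hBC j l (by omega) (by omega) (by omega))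
    · exact absurd h.symm (hBC l j (by omega) (by omega) (by omega))
    · rcases Nat.lt_trichotomy j l with g | g | g
      · exact absurd h (hCC j l g (by omega))
      · rw [g]
      · exact absurd h.symm (hCC l j g (by omega))
  have hsurj : Set.SurjOn a (Set.Icc 1 m) (Set.Icc 1 m) := by
    have := Finset.surjOn_of_injOn_of_card_le (s := Finset.Icc 1 m) (t := Finset.Icc 1 m) a
      (by simpa using hmaps) (by simpa using hinj) le_rfl
    simpa using this
  have key : ∀ j, 2 * j + 1 ≤ m → seqWeight m a (2 * j + 1) = if j % 2 = 0 then x else y := by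
    intro j hj
    rw [← hw j hj]
    unfold seqWeight
    have e1 : 2 * j + 1 - 1 = 2 * j := by omega
    have e2 : 2 * j + 1 + 1 = 2 * (j + 1) := by omega
    have e4 : 2 ≤ 2 * j + 1 ↔ 1 ≤ j := by omega
    simp only [e1, e2, e4, hae, hao]
  refine ⟨a, ⟨hmaps, hinj, hsurj⟩, x, y, hxy, ?_, ?_⟩
  · intro i h1 h2 h3
    have := key (i / 2) (by omega)
    rwa [show 2 * (i / 2) + 1 = i by omega, if_pos (by omega)] at this
  · intro i h1 h2 h3
    have := key (i / 2) (by omega)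
    rwa [show 2 * (i / 2) + 1 = i by omega, if_neg (by omega)] at this

def b15 (j : ℕ) : ℕ := [0, 5, 3, 6, 1, 7, 2, 4].getD j 0
def c15 (j : ℕ) : ℕ := [15, 9, 11, 10, 12, 8, 14, 13].getD j 0

def b0 (h j : ℕ) : ℕ := if j % 2 = 0 then j / 2 else h + 1 + j / 2
def c0 (h j : ℕ) : ℕ := if j % 2 = 0 then 4 * h - 1 - j else 4 * h + 1 - j

def b2 (h j : ℕ) : ℕ := if j % 2 = 0 then 2 * h + 2 - j / 2 else h + 1 - j / 2
def c2 (h j : ℕ) : ℕ :=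
  if j = 0 then 4 * h + 2 else if j % 2 = 0 then 2 * h + j else 2 * h + 2 + j

def b5 (t j : ℕ) : ℕ :=
  if j ≤ 2 * t + 1 then (if j % 2 = 0 then j - 1 else 2 * t + 1 + j)
  else (if j % 2 = 0 then 6 * t + 5 - j else 4 * t + 3 - j)
def c5 (t j : ℕ) : ℕ :=
  if j % 2 = 0 then
    (if j = 0 then 8 * t + 5 else if j ≤ 2 * t then 8 * t + 6 - 2 * j else 2 * j)
  else
    (if j < 2 * t + 1 then 8 * t + 5 - 2 * j else if j = 2 * t + 1 then 2 * t + 1 else 2 * j - 1)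

def b1 (t j : ℕ) : ℕ :=
  if j ≤ 2 * t + 1 then (if j % 2 = 0 then j - 1 else 2 * t + j)
  else (if j % 2 = 0 then 6 * t + 2 - j else 4 * t + 1 - j)
def c1 (t j : ℕ) : ℕ :=
  if j % 2 = 0 then
    (if j = 0 then 8 * t + 1 else if j ≤ 2 * t then 8 * t + 2 - 2 * j else 2 * j)
  else
    (if j < 2 * t + 1 then 8 * t + 1 - 2 * j else if j = 2 * t + 1 then 2 * t else 2 * j - 1)

def b3 (t j : ℕ) : ℕ :=
  if j % 2 = 0 then 2 * t + 1 - j / 2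
  else if j ≤ 2 * t + 1 then 3 * t + 1 - j / 2 else 5 * t + 2 - j / 2
def c3 (t j : ℕ) : ℕ :=
  if j % 2 = 0 then
    (if j = 0 then 8 * t + 3 else if j ≤ 2 * t then 6 * t + 2 + j else 4 * t + 1 + j)
  else
    (if j ≤ 2 * t + 1 then 4 * t + 1 + j else 2 * t + j)

def b7 (t j : ℕ) : ℕ :=
  if j % 2 = 0 then
    (if j + 4 ≤ 2 * t then j else if j + 4 ≤ 4 * t then 4 * t - 3 - j
     else if j + 2 = 4 * t then 4 * t + 1 else if j = 4 * t then 4 * t + 2 else 4 * t + 3)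
  else
    (if j + 3 ≤ 2 * t then 2 * t + 3 + j else if j + 3 ≤ 4 * t then 6 * t - 2 - j
     else if j + 1 = 4 * t then 2 * t - 2 else if j = 4 * t + 1 then 2 * t else 2 * t + 2)
def c7 (t j : ℕ) : ℕ :=
  if j % 2 = 0 then
    (if j + 4 ≤ 2 * t then 8 * t + 5 - 2 * j else if j + 4 ≤ 4 * t then 15 + 2 * j
     else if j + 2 = 4 * t then 4 * t + 10 else if j = 4 * t then 4 * t + 7 else 4 * t + 4)
  else
    (if j + 5 ≤ 2 * t then 8 * t + 4 - 2 * j else if j + 3 = 2 * t then 4 * t + 9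
     else if j + 5 ≤ 4 * t then 14 + 2 * j
     else if j + 3 = 4 * t then 4 * t + 6 else if j + 1 = 4 * t then 4 * t + 8
     else if j = 4 * t + 1 then 4 * t + 5 else 8 * t + 6)

set_option maxHeartbeats 0 in
theorem case_b0 (m h : ℕ) (h1 : 1 ≤ h) (hm : m = 4 * h) :
    ∃ a : ℕ → ℕ, Set.BijOn a (Set.Icc 1 m) (Set.Icc 1 m) ∧
      ∃ x y : ℕ, x ≠ y ∧
        (∀ i, 1 ≤ i → i ≤ m → i % 4 = 1 → seqWeight m a i = x) ∧
        (∀ i, 1 ≤ i → i ≤ m → i % 4 = 3 → seqWeight m a i = y) := by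
  subst hm
  apply twoSum_of_parts (4 * h) (b0 h) (c0 h) (5 * h) (5 * h + 2) (by omega) <;>
  intros <;> simp only [b0, c0] <;> split_ifs <;> omega

set_option maxHeartbeats 0 in
theorem case_b2 (m h : ℕ) (h1 : 1 ≤ h) (hm : m = 4 * h + 2) :
    ∃ a : ℕ → ℕ, Set.BijOn a (Set.Icc 1 m) (Set.Icc 1 m) ∧
      ∃ x y : ℕ, x ≠ y ∧
        (∀ i, 1 ≤ i → i ≤ m → i % 4 = 1 → seqWeight m a i = x) ∧
        (∀ i, 1 ≤ i → i ≤ m → i % 4 = 3 → seqWeight m a i = y) := by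
  subst hm
  apply twoSum_of_parts (4 * h + 2) (b2 h) (c2 h) (5 * h + 3) (5 * h + 5) (by omega) <;>
  intros <;> simp only [b2, c2] <;> split_ifs <;> omega

set_option maxHeartbeats 0 in
theorem case_b1 (m t : ℕ) (h1 : 1 ≤ t) (hm : m = 8 * t + 1) :
    ∃ a : ℕ → ℕ, Set.BijOn a (Set.Icc 1 m) (Set.Icc 1 m) ∧
      ∃ x y : ℕ, x ≠ y ∧
        (∀ i, 1 ≤ i → i ≤ m → i % 4 = 1 → seqWeight m a i = x) ∧
        (∀ i, 1 ≤ i → i ≤ m → i % 4 = 3 → seqWeight m a i = y) := by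
  subst hm
  apply twoSum_of_parts (8 * t + 1) (b1 t) (c1 t) (10 * t + 2) (10 * t + 1) (by omega) <;>
  intros <;> simp only [b1, c1] <;> split_ifs <;> omega

set_option maxHeartbeats 0 in
theorem case_b3 (m t : ℕ) (hm : m = 8 * t + 3) :
    ∃ a : ℕ → ℕ, Set.BijOn a (Set.Icc 1 m) (Set.Icc 1 m) ∧
      ∃ x y : ℕ, x ≠ y ∧
        (∀ i, 1 ≤ i → i ≤ m → i % 4 = 1 → seqWeight m a i = x) ∧
        (∀ i, 1 ≤ i → i ≤ m → i % 4 = 3 → seqWeight m a i = y) := by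
  subst hm
  apply twoSum_of_parts (8 * t + 3) (b3 t) (c3 t) (11 * t + 4) (9 * t + 3) (by omega) <;>
  intros <;> simp only [b3, c3] <;> split_ifs <;> omega

set_option maxHeartbeats 0 in
theorem case_b5 (m t : ℕ) (hm : m = 8 * t + 5) :
    ∃ a : ℕ → ℕ, Set.BijOn a (Set.Icc 1 m) (Set.Icc 1 m) ∧
      ∃ x y : ℕ, x ≠ y ∧
        (∀ i, 1 ≤ i → i ≤ m → i % 4 = 1 → seqWeight m a i = x) ∧
        (∀ i, 1 ≤ i → i ≤ m → i % 4 = 3 → seqWeight m a i = y) := by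
  subst hm
  apply twoSum_of_parts (8 * t + 5) (b5 t) (c5 t) (10 * t + 7) (10 * t + 6) (by omega) <;>
  intros <;> simp only [b5, c5] <;> split_ifs <;> omega

set_option maxHeartbeats 0 in
theorem case_b7 (m t : ℕ) (h1 : 2 ≤ t) (hm : m = 8 * t + 7) :
    ∃ a : ℕ → ℕ, Set.BijOn a (Set.Icc 1 m) (Set.Icc 1 m) ∧
      ∃ x y : ℕ, x ≠ y ∧
        (∀ i, 1 ≤ i → i ≤ m → i % 4 = 1 → seqWeight m a i = x) ∧
        (∀ i, 1 ≤ i → i ≤ m → i % 4 = 3 → seqWeight m a i = y) := by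
  subst hm
  apply twoSum_of_parts (8 * t + 7) (b7 t) (c7 t) (10 * t + 9) (10 * t + 8) (by omega)
  · intros; simp only [b7]; split_ifs <;> omega
  · intros; simp only [c7]; split_ifs <;> omega
  · intro j l _ _ _
    rcases Nat.mod_two_eq_zero_or_one j with p | p <;>
    rcases Nat.mod_two_eq_zero_or_one l with q | q <;>
    simp only [b7, p, q, if_true, one_ne_zero, if_false] <;> split_ifs <;> omega
  · intro j l _ _
    rcases Nat.mod_two_eq_zero_or_one j with p | p <;>
    rcases Nat.mod_two_eq_zero_or_one l with q | q <;>
    simp only [c7, p, q, if_true, one_ne_zero, if_false] <;> split_ifs <;> omega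
  · intro j l _ _ _
    rcases Nat.mod_two_eq_zero_or_one j with p | p <;>
    rcases Nat.mod_two_eq_zero_or_one l with q | q <;>
    simp only [b7, c7, p, q, if_true, one_ne_zero, if_false] <;> split_ifs <;> omega
  · intro j _
    rcases Nat.mod_two_eq_zero_or_one j with p | p
    · have q : (j + 1) % 2 = 1 := by omega
      simp only [b7, c7, p, q, if_true, one_ne_zero, if_false]; split_ifs <;> omega
    · have q : (j + 1) % 2 = 0 := by omega
      simp only [b7, c7, p, q, if_true, one_ne_zero, if_false]; split_ifs <;> omega

theorem stmt0 :
    ∀ m : ℕ, 3 ≤ m → m ≠ 7 →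
    ∃ a : ℕ → ℕ, Set.BijOn a (Set.Icc 1 m) (Set.Icc 1 m) ∧
      ∃ x y : ℕ, x ≠ y ∧
        (∀ i, 1 ≤ i → i ≤ m → i % 4 = 1 → seqWeight m a i = x) ∧
        (∀ i, 1 ≤ i → i ≤ m → i % 4 = 3 → seqWeight m a i = y) := by
  intro m hm hm7
  have hcases : (∃ h, 1 ≤ h ∧ m = 4 * h) ∨ (∃ h, 1 ≤ h ∧ m = 4 * h + 2) ∨
      (∃ t, 1 ≤ t ∧ m = 8 * t + 1) ∨ (∃ t, m = 8 * t + 3) ∨ (∃ t, m = 8 * t + 5) ∨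
      m = 15 ∨ (∃ t, 2 ≤ t ∧ m = 8 * t + 7) := by
    have : m % 4 = 0 ∨ m % 4 = 2 ∨ m % 8 = 1 ∨ m % 8 = 3 ∨ m % 8 = 5 ∨ m = 15 ∨
      (m % 8 = 7 ∧ m ≠ 15) := by omega
    rcases this with h | h | h | h | h | h | h
    · exact Or.inl ⟨m / 4, by omega, by omega⟩
    · exact Or.inr (Or.inl ⟨m / 4, by omega, by omega⟩)
    · exact Or.inr (Or.inr (Or.inl ⟨m / 8, by omega, by omega⟩))
    · exact Or.inr (Or.inr (Or.inr (Or.inl ⟨m / 8, by omega⟩)))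
    · exact Or.inr (Or.inr (Or.inr (Or.inr (Or.inl ⟨m / 8, by omega⟩))))
    · exact Or.inr (Or.inr (Or.inr (Or.inr (Or.inr (Or.inl h)))))
    · exact Or.inr (Or.inr (Or.inr (Or.inr (Or.inr (Or.inr ⟨m / 8, by omega, by omega⟩)))))
  rcases hcases with ⟨h, h1, rfl⟩ | ⟨h, h1, rfl⟩ | ⟨t, h1, rfl⟩ | ⟨t, rfl⟩ | ⟨t, rfl⟩ | rfl |
    ⟨t, h1, rfl⟩
  · exact case_b0 _ h h1 rfl
  · exact case_b2 _ h h1 rfl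
  · exact case_b1 _ t h1 rfl
  · exact case_b3 _ t rfl
  · exact case_b5 _ t rfl
  · have hB : ∀ j < 8, 1 ≤ j → 1 ≤ b15 j ∧ b15 j ≤ 15 := by decide
    have hC : ∀ j < 8, 1 ≤ c15 j ∧ c15 j ≤ 15 := by decide
    have hBB : ∀ j < 8, ∀ l < 8, 1 ≤ j → j < l → b15 j ≠ b15 l := by decide
    have hCC : ∀ j < 8, ∀ l < 8, j < l → c15 j ≠ c15 l := by decide
    have hBC : ∀ j < 8, ∀ l < 8, 1 ≤ j → b15 j ≠ c15 l := by decide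
    have hw : ∀ j < 8, (if 1 ≤ j then b15 j else 0) + c15 j +
        (if 2 * j + 2 ≤ 15 then b15 (j + 1) else 0) = if j % 2 = 0 then 20 else 17 := by decide
    exact twoSum_of_parts 15 b15 c15 20 17 (by omega)
      (fun j h1 h2 => hB j (by omega) h1)
      (fun j h1 => hC j (by omega))
      (fun j l h1 h2 h3 => hBB j (by omega) l (by omega) h1 h2)
      (fun j l h1 h2 => hCC j (by omega) l (by omega) h1)
      (fun j l h1 h2 h3 => hBC j (by omega) l (by omega) h1)
      (fun j h1 => hw j (by omega))
  · exact case_b7 _ t h1 rfl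
end

section
/- For every integer k ≥ 2, there exists a permutation a₁, …, a_m of {1, …, m} with m = 8k + 1 such that every position i ≡ 1 (mod 4) has weight 10k + 1 and every position i ≡ 3 (mod 4) has weight 11k. -/
/-- The explicit permutation. -/
def permA (k n : ℕ) : ℕ :=
  let i := (n + 2) / 4
  if n % 4 = 2 then (if i ≤ k then 2*k + i - 1 else 2*i - 2*k - 1)
  else if n % 4 = 0 then
    (if i < k then 2*k - 2*i else if i = k then 4*k else if i < 2*k then 7*k - i else 3*k)
  else if n % 4 = 3 then
    (if i < k then 7*k + 1 + i else if i = k then 4*k + 1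
      else if i < 2*k then 6*k + 1 - i else 6*k + 1)
  else
    (if i = 0 then 8*k + 1 else if i < k then 6*k + 1 + i else if i = k then 6*k
      else if i < 2*k then 5*k - i else 7*k + 1)

/-- Its inverse. -/
def permB (k v : ℕ) : ℕ :=
  if v < 2*k then (if v % 2 = 1 then 2*v + 4*k else 4*k - 2*v)
  else if v < 3*k then 4*(v + 1 - 2*k) - 2
  else if v = 3*k then 8*k
  else if v < 4*k then 4*(5*k - v) + 1
  else if v = 4*k then 4*k
  else if v = 4*k + 1 then 4*k - 1
  else if v ≤ 5*k then 4*(6*k + 1 - v) - 1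
  else if v < 6*k then 4*(7*k - v)
  else if v = 6*k then 4*k + 1
  else if v = 6*k + 1 then 8*k - 1
  else if v ≤ 7*k then 4*(v - 6*k - 1) + 1
  else if v = 7*k + 1 then 8*k + 1
  else if v ≤ 8*k then 4*(v - 7*k - 1) - 1
  else 1

theorem permA_maps (k n : ℕ) (hk : 2 ≤ k) (h1 : 1 ≤ n) (h2 : n ≤ 8*k + 1) :
    1 ≤ permA k n ∧ permA k n ≤ 8*k + 1 := by
  unfold permA
  dsimp only
  split_ifs <;> omega

set_option maxHeartbeats 4000000 in
theorem permB_permA (k n : ℕ) (hk : 2 ≤ k) (h1 : 1 ≤ n) (h2 : n ≤ 8*k + 1) :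
    permB k (permA k n) = n := by
  obtain ⟨v, hv⟩ : ∃ v, v = permA k n := ⟨_, rfl⟩
  rw [← hv]
  unfold permA at hv
  obtain ⟨i, hi⟩ : ∃ i, i = (n + 2) / 4 := ⟨_, rfl⟩
  simp only [← hi] at hv
  unfold permB
  split_ifs at hv <;>
    ((repeat first | rw [if_pos (by omega)] | rw [if_neg (by omega)]); omega)

set_option maxHeartbeats 4000000 in
theorem stmt16 :
    ∀ k : ℕ, 2 ≤ k →
    ∃ a : ℕ → ℕ, Set.BijOn a (Set.Icc 1 (8*k + 1)) (Set.Icc 1 (8*k + 1)) ∧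
      (∀ i, 1 ≤ i → i ≤ 8*k + 1 → i % 4 = 1 → seqWeight (8*k + 1) a i = 10*k + 1) ∧
      (∀ i, 1 ≤ i → i ≤ 8*k + 1 → i % 4 = 3 → seqWeight (8*k + 1) a i = 11*k) := by
  intro k hk
  have hm : Set.MapsTo (permA k) (Set.Icc 1 (8*k + 1)) (Set.Icc 1 (8*k + 1)) :=
    fun n hn => permA_maps k n hk hn.1 hn.2
  have hi : Set.InjOn (permA k) (Set.Icc 1 (8*k + 1)) := by
    intro x hx y hy hxy
    rw [← permB_permA k x hk hx.1 hx.2, hxy, permB_permA k y hk hy.1 hy.2]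
  refine ⟨permA k, ⟨hm, hi, ?_⟩, ?_, ?_⟩
  · have := Finset.surjOn_of_injOn_of_card_le (s := Finset.Icc 1 (8*k + 1))
      (t := Finset.Icc 1 (8*k + 1)) (permA k) (by simpa using hm) (by simpa using hi) le_rfl
    simpa using this
  · intro n h1 h2 h3
    obtain ⟨i, rfl⟩ : ∃ i, n = 4*i + 1 := ⟨n / 4, by omega⟩
    have e1 : (4*i + 1 - 1 + 2) / 4 = i := by omega
    have e2 : (4*i + 1 + 2) / 4 = i := by omega
    have e3 : (4*i + 1 + 1 + 2) / 4 = i + 1 := by omega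
    have m1 : (4*i + 1 - 1) % 4 = 0 := by omega
    have m3 : (4*i + 1 + 1) % 4 = 2 := by omega
    simp only [seqWeight, permA, e1, e2, e3, m1, h3, m3]
    norm_num
    split_ifs <;> omega
  · intro n h1 h2 h3
    obtain ⟨i, rfl⟩ : ∃ i, n = 4*i + 3 := ⟨n / 4, by omega⟩
    have e1 : (4*i + 3 - 1 + 2) / 4 = i + 1 := by omega
    have e2 : (4*i + 3 + 2) / 4 = i + 1 := by omega
    have e3 : (4*i + 3 + 1 + 2) / 4 = i + 1 := by omega
    have m1 : (4*i + 3 - 1) % 4 = 2 := by omega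
    have m3 : (4*i + 3 + 1) % 4 = 0 := by omega
    simp only [seqWeight, permA, e1, e2, e3, m1, h3, m3]
    norm_num
    split_ifs <;> omega
end

section
/- For every integer k ≥ 3, there exists a permutation a₁, …, a_m of {1, …, m} with m = 8k + 5 such that every position i ≡ 1 (mod 4) has weight 11k + 7 and every position i ≡ 3 (mod 4) has weight 13k + 10. -/
/-- The explicit permutation. -/
def permSeq (k p : ℕ) : ℕ :=
  let t := p / 4
  if p % 4 = 2 then
    (if t < 2*k then 8*k + 4 - t else 5*k + 4)
  else if p % 4 = 0 then
    (if t ≤ k then 2*t + 1 else if t ≤ 2*k then 2*t - 2*k else 8*k + 5)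
  else if p % 4 = 1 then
    (if t = 0 then 3*k + 3 else if t ≤ k then 3*k + 2 - t
      else if t < 2*k then 5*k + 3 - t else if t = 2*k then 4*k + 3 else 3*k + 2)
  else
    (if t < k then 5*k + 3 - t else if t < 2*k then 7*k + 4 - t else 1)

theorem permSeq_r0 (k t : ℕ) : permSeq k (4*t) =
    if t ≤ k then 2*t + 1 else if t ≤ 2*k then 2*t - 2*k else 8*k + 5 := by
  have h1 : (4*t) / 4 = t := by omega
  have h2 : (4*t) % 4 = 0 := by omega
  simp [permSeq]

theorem permSeq_r1 (k t : ℕ) : permSeq k (4*t+1) =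
    if t = 0 then 3*k + 3 else if t ≤ k then 3*k + 2 - t
      else if t < 2*k then 5*k + 3 - t else if t = 2*k then 4*k + 3 else 3*k + 2 := by
  have h1 : (4*t+1) / 4 = t := by omega
  have h2 : (4*t+1) % 4 = 1 := by omega
  simp [permSeq, h1, h2]

theorem permSeq_r2 (k t : ℕ) : permSeq k (4*t+2) =
    if t < 2*k then 8*k + 4 - t else 5*k + 4 := by
  have h1 : (4*t+2) / 4 = t := by omega
  have h2 : (4*t+2) % 4 = 2 := by omega
  simp [permSeq, h1, h2]

theorem permSeq_r3 (k t : ℕ) : permSeq k (4*t+3) =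
    if t < k then 5*k + 3 - t else if t < 2*k then 7*k + 4 - t else 1 := by
  have h1 : (4*t+3) / 4 = t := by omega
  have h2 : (4*t+3) % 4 = 3 := by omega
  simp [permSeq, h1, h2]

theorem permSeq_surj (k : ℕ) (hk : 3 ≤ k) (v : ℕ) (h1 : 1 ≤ v) (h2 : v ≤ 8*k + 5) :
    ∃ p, 1 ≤ p ∧ p ≤ 8*k + 5 ∧ permSeq k p = v := by
  have cases : v = 1 ∨ (2 ≤ v ∧ v ≤ 2*k ∧ v % 2 = 0) ∨ (3 ≤ v ∧ v ≤ 2*k+1 ∧ v % 2 = 1) ∨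
      (2*k+2 ≤ v ∧ v ≤ 3*k+1) ∨ v = 3*k+2 ∨ v = 3*k+3 ∨ (3*k+4 ≤ v ∧ v ≤ 4*k+2) ∨
      v = 4*k+3 ∨ (4*k+4 ≤ v ∧ v ≤ 5*k+3) ∨ v = 5*k+4 ∨ (5*k+5 ≤ v ∧ v ≤ 6*k+4) ∨
      (6*k+5 ≤ v ∧ v ≤ 8*k+4) ∨ v = 8*k+5 := by omega
  rcases cases with h | h | h | h | h | h | h | h | h | h | h | h | h
  · refine ⟨4*(2*k) + 3, by omega, by omega, ?_⟩
    rw [permSeq_r3]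
    split_ifs <;> omega
  · refine ⟨4*(k + v/2), by omega, by omega, ?_⟩
    rw [permSeq_r0]
    split_ifs <;> omega
  · refine ⟨4*(v/2), by omega, by omega, ?_⟩
    rw [permSeq_r0]
    split_ifs <;> omega
  · refine ⟨4*(3*k+2-v) + 1, by omega, by omega, ?_⟩
    rw [permSeq_r1]
    split_ifs <;> omega
  · refine ⟨4*(2*k+1) + 1, by omega, by omega, ?_⟩
    rw [permSeq_r1]
    rw [if_neg (by omega), if_neg (by omega), if_neg (by omega), if_neg (by omega)]
    omega
  · refine ⟨4*0 + 1, by omega, by omega, ?_⟩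
    rw [permSeq_r1]
    split_ifs <;> omega
  · refine ⟨4*(5*k+3-v) + 1, by omega, by omega, ?_⟩
    rw [permSeq_r1]
    split_ifs <;> omega
  · refine ⟨4*(2*k) + 1, by omega, by omega, ?_⟩
    rw [permSeq_r1]
    split_ifs <;> omega
  · refine ⟨4*(5*k+3-v) + 3, by omega, by omega, ?_⟩
    rw [permSeq_r3]
    split_ifs <;> omega
  · refine ⟨4*(2*k) + 2, by omega, by omega, ?_⟩
    rw [permSeq_r2]
    split_ifs <;> omega
  · refine ⟨4*(7*k+4-v) + 3, by omega, by omega, ?_⟩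
    rw [permSeq_r3]
    split_ifs <;> omega
  · refine ⟨4*(8*k+4-v) + 2, by omega, by omega, ?_⟩
    rw [permSeq_r2]
    split_ifs <;> omega
  · refine ⟨4*(2*k+1), by omega, by omega, ?_⟩
    rw [permSeq_r0]
    split_ifs <;> omega

theorem bijOn_of_surj (n : ℕ) (a : ℕ → ℕ)
    (h : ∀ v, 1 ≤ v → v ≤ n → ∃ p, 1 ≤ p ∧ p ≤ n ∧ a p = v) :
    Set.BijOn a (Set.Icc 1 n) (Set.Icc 1 n) := by
  have hsub : Finset.Icc 1 n ⊆ (Finset.Icc 1 n).image a := by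
    intro v hv
    rw [Finset.mem_Icc] at hv
    obtain ⟨p, h1, h2, h3⟩ := h v hv.1 hv.2
    exact Finset.mem_image.2 ⟨p, Finset.mem_Icc.2 ⟨h1, h2⟩, h3⟩
  have heq := Finset.eq_of_subset_of_card_le hsub Finset.card_image_le
  have hinj : Set.InjOn a (Finset.Icc 1 n : Finset ℕ) :=
    Finset.card_image_iff.1 (by rw [← heq])
  rw [Finset.coe_Icc] at hinj
  refine ⟨?_, hinj, ?_⟩
  · intro p hp
    have : a p ∈ (Finset.Icc 1 n).image a :=
      Finset.mem_image.2 ⟨p, Finset.mem_Icc.2 hp, rfl⟩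
    rw [← heq] at this
    exact Finset.mem_Icc.1 this
  · intro v hv
    obtain ⟨p, h1, h2, h3⟩ := h v hv.1 hv.2
    exact ⟨p, ⟨h1, h2⟩, h3⟩

theorem stmt17 :
    ∀ k : ℕ, 3 ≤ k →
    ∃ a : ℕ → ℕ, Set.BijOn a (Set.Icc 1 (8*k + 5)) (Set.Icc 1 (8*k + 5)) ∧
      (∀ i, 1 ≤ i → i ≤ 8*k + 5 → i % 4 = 1 → seqWeight (8*k + 5) a i = 11*k + 7) ∧
      (∀ i, 1 ≤ i → i ≤ 8*k + 5 → i % 4 = 3 → seqWeight (8*k + 5) a i = 13*k + 10) := by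
  intro k hk
  refine ⟨permSeq k, bijOn_of_surj _ _ (permSeq_surj k hk), ?_, ?_⟩
  · intro i h1 h2 h3
    obtain ⟨t, rfl⟩ : ∃ t, i = 4*t + 1 := ⟨i/4, by omega⟩
    unfold seqWeight
    have e1 : 4*t + 1 - 1 = 4*t := by omega
    rw [e1, permSeq_r0, permSeq_r1, permSeq_r2]
    split_ifs <;> omega
  · intro i h1 h2 h3
    obtain ⟨t, rfl⟩ : ∃ t, i = 4*t + 3 := ⟨i/4, by omega⟩
    unfold seqWeight
    have e1 : 4*t + 3 - 1 = 4*t + 2 := by omega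
    have e2 : 4*t + 3 + 1 = 4*(t+1) := by omega
    rw [e1, e2, permSeq_r0, permSeq_r2, permSeq_r3]
    split_ifs <;> omega
end
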